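/- Let A be an n × n matrix with nonnegative real entries. Define γ(0) = 0 and γ(k) = (k!)^{1/k} for integers k ≥ 1, and δ(k) = γ(k) − γ(k−1). For each row i, let a*_{i1} ≥ a*_{i2} ≥ ⋯ ≥ a*_{in} be the entries of row i sorted in nonincreasing order (i.e., a*_{ij} = A(i, τ_i(j)) for some permutation τ_i of {1,…,n} making j ↦ A(i, τ_i(j)) nonincreasing). Then the permanent of A, per(A) = Σ_{σ ∈ S_n} ∏_{j=1}^n A(j, σ(j)), satisfies per(A) ≤ ∏_{i=1}^n Σ_{j=1}^n a*_{ij} · δ(j). -/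

import Mathlib

/-- The permanent of a square matrix: `per A = ∑ σ, ∏ j, A j (σ j)`. -/
noncomputable def perm {n : ℕ} (A : Matrix (Fin n) (Fin n) ℝ) : ℝ :=
  ∑ σ : Equiv.Perm (Fin n), ∏ j, A j (σ j)

/-- `γ 0 = 0` and `γ k = (k!)^(1/k)` for `k ≥ 1`. -/
noncomputable def gam : ℕ → ℝ
  | 0 => 0
  | (k + 1) => ((k + 1).factorial : ℝ) ^ (1 / ((k : ℝ) + 1))

/-- `δ k = γ k - γ (k - 1)`. -/
noncomputable def del (k : ℕ) : ℝ := gam k - gam (k - 1)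

/-- The permutations `σ` with `σ i ∈ B i` for all `i`. -/
def restrictedPerms {α : Type*} [Fintype α] [DecidableEq α] (B : α → Finset α) :
    Finset (Equiv.Perm α) :=
  Finset.univ.filter fun σ => ∀ i, σ i ∈ B i

/-- Force the value `k` at `i`, and forbid it elsewhere. -/
def pinAt {α : Type*} [DecidableEq α] (B : α → Finset α) (i k : α) : α → Finset α :=
  fun j => if j = i then {k} else (B j).erase k

lemma pinAt_le {α : Type*} [DecidableEq α] {B : α → Finset α} {i k : α} (hk : k ∈ B i) :
    pinAt B i k ≤ B := by
  intro j
  by_cases h : j = i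
  · subst h; simpa [pinAt] using hk
  · simpa [pinAt, h] using Finset.erase_subset k (B j)

/-- The logarithm of `gam`. -/
noncomputable def logGam (k : ℕ) : ℝ := Real.log (k.factorial : ℝ) / k

lemma logGam_one : logGam 1 = 0 := by simp [logGam]

lemma gam_eq_exp_logGam {k : ℕ} (hk : k ≠ 0) : gam k = Real.exp (logGam k) := by
  obtain ⟨k, rfl⟩ := Nat.exists_eq_succ_of_ne_zero hk
  have : (0 : ℝ) < ((k + 1).factorial : ℝ) := by exact_mod_cast Nat.factorial_pos _
  simp only [gam, logGam, Nat.succ_eq_add_one]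
  rw [Real.rpow_def_of_pos this]
  push_cast
  ring_nf

lemma gam_nonneg (k : ℕ) : 0 ≤ gam k := by
  cases k with
  | zero => simp [gam]
  | succ k => rw [gam_eq_exp_logGam k.succ_ne_zero]; positivity

lemma natCast_mul_logGam (k : ℕ) : (k : ℝ) * logGam k = Real.log (k.factorial : ℝ) := by
  rcases eq_or_ne k 0 with rfl | hk
  · simp
  · have : (k : ℝ) ≠ 0 := by exact_mod_cast hk
    simp [logGam]; field_simp

section RestrictedPerms

variable {α : Type*} [Fintype α] [DecidableEq α]

lemma mem_restrictedPerms {B : α → Finset α} {σ : Equiv.Perm α} :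
    σ ∈ restrictedPerms B ↔ ∀ i, σ i ∈ B i := by simp [restrictedPerms]

lemma restrictedPerms_pinAt {B : α → Finset α} {i k : α} (hk : k ∈ B i) :
    restrictedPerms (pinAt B i k) = (restrictedPerms B).filter fun σ => σ i = k := by
  ext σ
  simp only [mem_restrictedPerms, Finset.mem_filter]
  constructor
  · intro h
    exact ⟨fun j => pinAt_le hk j (h j), by simpa [pinAt] using h i⟩
  · rintro ⟨h, hi⟩ j
    by_cases hj : j = i
    · subst hj; simp [pinAt, hi]
    · have : σ j ≠ k := fun e => hj (σ.injective (e.trans hi.symm))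
      simp [pinAt, hj, this, h j]

lemma sum_log_pinAt_nonneg (B : α → Finset α) (i : α) :
    0 ≤ ∑ σ ∈ restrictedPerms B, (Real.log (B i).card +
      Real.log (restrictedPerms (pinAt B i (σ i))).card -
        Real.log (restrictedPerms B).card) := by
  set p : ℝ := ((restrictedPerms B).card : ℝ) with hp
  set r : ℝ := ((B i).card : ℝ) with hr
  let q : α → ℝ := fun k => ((restrictedPerms (pinAt B i k)).card : ℝ)
  have hterm : ∀ σ ∈ restrictedPerms B,
      1 - p / r * (q (σ i))⁻¹ ≤ Real.log r + Real.log (q (σ i)) - Real.log p := by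
    intro σ hσ
    have hσi := mem_restrictedPerms.1 hσ i
    have hp0 : 0 < p := Nat.cast_pos.2 (Finset.card_pos.2 ⟨σ, hσ⟩)
    have hr0 : 0 < r := Nat.cast_pos.2 (Finset.card_pos.2 ⟨_, hσi⟩)
    have hq0 : 0 < q (σ i) := by
      refine Nat.cast_pos.2 (Finset.card_pos.2 ⟨σ, ?_⟩)
      rw [restrictedPerms_pinAt hσi]
      simp [hσ]
    have h := Real.log_le_sub_one_of_pos (x := p / r * (q (σ i))⁻¹) (by positivity)
    rw [Real.log_mul (by positivity) (by positivity),
      Real.log_div hp0.ne' hr0.ne', Real.log_inv] at h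
    linarith
  have hinv : ∑ σ ∈ restrictedPerms B, (q (σ i))⁻¹ ≤ r := by
    rw [← Finset.sum_fiberwise_of_maps_to (t := B i) (g := fun σ => σ i)
      fun σ hσ => mem_restrictedPerms.1 hσ i, hr, Finset.card_eq_sum_ones, Nat.cast_sum]
    refine Finset.sum_le_sum fun k hk => ?_
    have : ∀ σ ∈ (restrictedPerms B).filter (fun σ => σ i = k), (q (σ i))⁻¹ = (q k)⁻¹ := by
      intro σ hσ
      rw [(Finset.mem_filter.1 hσ).2]
    rw [Finset.sum_congr rfl this, Finset.sum_const, ← restrictedPerms_pinAt hk, nsmul_eq_mul]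
    simpa using mul_inv_le_one (a := q k)
  refine le_trans ?_ (Finset.sum_le_sum hterm)
  rw [Finset.sum_sub_distrib, ← Finset.mul_sum, Finset.sum_const, nsmul_eq_mul, mul_one, ← hp]
  have hp0 : 0 ≤ p := Nat.cast_nonneg _
  have hr0 : 0 ≤ r := Nat.cast_nonneg _
  have h1 : p / r * ∑ σ ∈ restrictedPerms B, (q (σ i))⁻¹ ≤ p / r * r :=
    mul_le_mul_of_nonneg_left hinv (by positivity)
  have h2 : p / r * r ≤ p := by
    rcases eq_or_ne r 0 with h | h
    · simpa [h] using hp0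
    · exact (div_mul_cancel₀ p h).le
  linarith

/-- The contribution of a single row `j` to the recursive bound, summed over all pinned `i`. -/
lemma log_card_add_sum_logGam_pinAt {B : α → Finset α} {σ : Equiv.Perm α}
    (hσ : σ ∈ restrictedPerms B) (j : α) :
    Real.log (B j).card + ∑ i, logGam (pinAt B i (σ i) j).card =
      Fintype.card α * logGam (B j).card := by
  have hσ' := mem_restrictedPerms.1 hσ
  obtain ⟨r, hr⟩ : ∃ r, (B j).card = r + 1 :=
    Nat.exists_eq_succ_of_ne_zero (Finset.card_pos.2 ⟨_, hσ' j⟩).ne'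
  have hterm : ∀ i, logGam (pinAt B i (σ i) j).card =
      logGam (r + 1) + (if σ i ∈ B j then logGam r - logGam (r + 1) else 0) -
        (if i = j then logGam r else 0) := by
    intro i
    by_cases hij : i = j
    · subst hij; simp [pinAt, hσ', logGam_one]
    · by_cases hm : σ i ∈ B j
      · simp [pinAt, Ne.symm hij, hij, hm, Finset.card_erase_of_mem hm, hr]
      · simp [pinAt, Ne.symm hij, hij, hm, hr]
  have hcount : ∑ i, (if σ i ∈ B j then logGam r - logGam (r + 1) else 0) =
      ((r : ℝ) + 1) * (logGam r - logGam (r + 1)) := by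
    rw [Equiv.sum_comp σ fun k => if k ∈ B j then logGam r - logGam (r + 1) else 0]
    simp [hr, mul_sub]
  simp_rw [hterm]
  rw [Finset.sum_sub_distrib, Finset.sum_add_distrib, hcount, hr]
  have h1 := natCast_mul_logGam r
  have h2 := natCast_mul_logGam (r + 1)
  rw [Nat.factorial_succ, Nat.cast_mul, Real.log_mul (by positivity)
    (by exact_mod_cast r.factorial_ne_zero)] at h2
  simp only [Finset.sum_const, Finset.card_univ, nsmul_eq_mul, Finset.sum_ite_eq',
    Finset.mem_univ, if_true]
  push_cast at h2 ⊢
  linarith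

lemma log_card_restrictedPerms_le (B : α → Finset α) (hne : (restrictedPerms B).Nonempty) :
    Real.log (restrictedPerms B).card ≤ ∑ i, logGam (B i).card := by
  induction B using WellFoundedLT.induction with
  | ind B ih =>
  by_contra! hlt
  set M := ∑ i, logGam (B i).card with hM
  let T : Equiv.Perm α → α → ℝ := fun σ i => ∑ j, logGam (pinAt B i (σ i) j).card
  have hmem : ∀ σ ∈ restrictedPerms B, ∀ i, σ ∈ restrictedPerms (pinAt B i (σ i)) := by
    intro σ hσ i
    rw [restrictedPerms_pinAt (mem_restrictedPerms.1 hσ i)]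
    simp [hσ]
  have hstrict : ∀ σ ∈ restrictedPerms B, ∀ i, pinAt B i (σ i) ≠ B →
      Real.log (B i).card + Real.log (restrictedPerms (pinAt B i (σ i))).card -
        Real.log (restrictedPerms B).card < Real.log (B i).card + T σ i - M := by
    intro σ hσ i h
    have := ih _ (lt_of_le_of_ne (pinAt_le (mem_restrictedPerms.1 hσ i)) h) ⟨σ, hmem σ hσ i⟩
    simp only [T]
    linarith
  have hle : ∀ σ ∈ restrictedPerms B, ∀ i,
      Real.log (B i).card + Real.log (restrictedPerms (pinAt B i (σ i))).card -
        Real.log (restrictedPerms B).card ≤ Real.log (B i).card + T σ i - M := by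
    intro σ hσ i
    by_cases h : pinAt B i (σ i) = B
    · simp [T, h, hM]
    · exact (hstrict σ hσ i h).le
  obtain ⟨σ, hσ, i, hi⟩ : ∃ σ ∈ restrictedPerms B, ∃ i, pinAt B i (σ i) ≠ B := by
    by_contra! hall
    obtain ⟨σ, hσ⟩ := hne
    have hB : ∀ i, B i = {σ i} := fun i => by
      rw [← congrFun (hall σ hσ i) i]; simp [pinAt]
    have hS : restrictedPerms B = {σ} := by
      ext ρ
      simp [mem_restrictedPerms, hB, Equiv.ext_iff]
    simp [hM, hS, hB, logGam_one] at hlt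
  have hzero : ∀ σ ∈ restrictedPerms B, ∑ i, (Real.log (B i).card + T σ i - M) = 0 := by
    intro σ hσ
    have h := Finset.sum_congr rfl fun j (_ : j ∈ Finset.univ) =>
      log_card_add_sum_logGam_pinAt hσ j
    rw [Finset.sum_add_distrib, Finset.sum_comm, ← Finset.mul_sum, ← hM] at h
    rw [Finset.sum_sub_distrib, Finset.sum_add_distrib]
    simp only [T, Finset.sum_const, Finset.card_univ, nsmul_eq_mul]
    linarith
  have hpos := Finset.sum_nonneg fun i (_ : i ∈ Finset.univ) => sum_log_pinAt_nonneg B i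
  rw [Finset.sum_comm] at hpos
  have hneg := Finset.sum_lt_sum
    (fun ρ hρ => Finset.sum_le_sum fun i (_ : i ∈ Finset.univ) => hle ρ hρ i)
    ⟨σ, hσ, Finset.sum_lt_sum (fun i _ => hle σ hσ i) ⟨i, Finset.mem_univ i, hstrict σ hσ i hi⟩⟩
  rw [Finset.sum_eq_zero hzero] at hneg
  linarith

/-- **Brègman's theorem**. -/
theorem card_restrictedPerms_le (B : α → Finset α) :
    ((restrictedPerms B).card : ℝ) ≤ ∏ i, gam (B i).card := by
  rcases (restrictedPerms B).eq_empty_or_nonempty with h | h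
  · rw [h]
    simpa using Finset.prod_nonneg fun i _ => gam_nonneg (B i).card
  · obtain ⟨σ, hσ⟩ := h
    have hcard : ∀ i, (B i).card ≠ 0 := fun i =>
      (Finset.card_pos.2 ⟨_, mem_restrictedPerms.1 hσ i⟩).ne'
    simp_rw [fun i => gam_eq_exp_logGam (hcard i)]
    rw [← Real.exp_sum, ← Real.log_le_iff_le_exp (Nat.cast_pos.2 (Finset.card_pos.2 ⟨σ, hσ⟩))]
    exact log_card_restrictedPerms_le B ⟨σ, hσ⟩

end RestrictedPerms

/-- A nonincreasing nonnegative sequence is a nonnegative combination of indicators of initial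
segments; its pairing with `del` is the corresponding combination of values of `gam`. -/
lemma exists_layer_decomposition {n : ℕ} (a : Fin n → ℝ) (ha : ∀ j, 0 ≤ a j)
    (hanti : Antitone a) :
    ∃ c : Fin n → ℝ, (∀ k, 0 ≤ c k) ∧ (∀ j, a j = ∑ k, c k * if j ≤ k then 1 else 0) ∧
      ∑ j, a j * del (j.val + 1) = ∑ k, c k * gam (k.val + 1) := by
  let f : ℕ → ℝ := fun j => if h : j < n then a ⟨j, h⟩ else 0
  have hf : ∀ j : Fin n, f j = a j := fun j => by simp [f]
  have hfn : f n = 0 := by simp [f]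
  refine ⟨fun k => f k - f (k + 1), fun k => ?_, fun j => ?_, ?_⟩
  · by_cases h : (k : ℕ) + 1 < n
    · have : a ⟨k + 1, h⟩ ≤ a k := hanti (by simp [Fin.le_def])
      simpa [f, h] using this
    · simpa [f, h] using ha k
  · have key : ∀ m, (j : ℕ) ≤ m →
        ∑ k ∈ Finset.range m, (f k - f (k + 1)) * (if (j : ℕ) ≤ k then 1 else 0) =
          f j - f m := by
      intro m hm
      induction m, hm using Nat.le_induction with
      | base =>
        rw [sub_self]
        refine Finset.sum_eq_zero fun k hk => ?_
        simp [Finset.mem_range.1 hk]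
      | succ m hm ih => rw [Finset.sum_range_succ, ih]; simp [hm]
    have h := key n j.2.le
    rw [← Fin.sum_univ_eq_sum_range
      (fun k => (f k - f (k + 1)) * (if (j : ℕ) ≤ k then 1 else 0)), hfn, sub_zero, hf] at h
    simpa only [Fin.le_def] using h.symm
  · have key : ∀ m, ∑ k ∈ Finset.range m, f k * del (k + 1) =
        ∑ k ∈ Finset.range m, (f k - f (k + 1)) * gam (k + 1) + f m * gam m := by
      intro m
      induction m with
      | zero => simp [gam]
      | succ m ih =>
        rw [Finset.sum_range_succ, ih, Finset.sum_range_succ]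
        simp only [del, Nat.add_sub_cancel]
        ring
    have h := key n
    rw [hfn, zero_mul, add_zero, ← Fin.sum_univ_eq_sum_range (fun k => f k * del (k + 1)),
      ← Fin.sum_univ_eq_sum_range (fun k => (f k - f (k + 1)) * gam (k + 1))] at h
    simpa only [hf] using h

/-- Soules's (2005) upper bound on the permanent: if the entries of each row `i` of a
nonnegative matrix `A` are rearranged in nonincreasing order `a*_{i1} ≥ ⋯ ≥ a*_{in}`
(via a permutation `τ i` of the columns), then
`per A ≤ ∏ i, ∑ j, a*_{ij} · δ j` (where here column index `j` runs over `1, …, n`). -/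
theorem soules_upper_bound
    {n : ℕ} (A : Matrix (Fin n) (Fin n) ℝ) (hA : ∀ i j, 0 ≤ A i j)
    (τ : Fin n → Equiv.Perm (Fin n))
    (h_sorted : ∀ i, Antitone (fun j => A i (τ i j))) :
    perm A ≤ ∏ i : Fin n, ∑ j : Fin n, A i (τ i j) * del (j.val + 1) := by
  choose c hc hrow hsum using fun i => exists_layer_decomposition
    (fun j => A i (τ i j)) (fun j => hA i _) (h_sorted i)
  have hentry : ∀ i m, A i m = ∑ k, c i k * if (τ i).symm m ≤ k then 1 else 0 := by
    intro i m
    simpa using hrow i ((τ i).symm m)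
  have hcard : ∀ (κ : Fin n → Fin n) (i : Fin n),
      (Finset.univ.filter fun m => (τ i).symm m ≤ κ i).card = (κ i : ℕ) + 1 := by
    intro κ i
    rw [← Fin.card_Iic (κ i)]
    exact Finset.card_bij' (fun m _ => (τ i).symm m) (fun j _ => τ i j)
      (by simp) (by simp) (by simp) (by simp)
  unfold perm
  simp_rw [hsum]
  simp_rw [hentry, Finset.prod_univ_sum, Finset.prod_mul_distrib]
  rw [Finset.sum_comm]
  refine Finset.sum_le_sum fun κ _ => ?_
  rw [← Finset.mul_sum]
  refine mul_le_mul_of_nonneg_left ?_ (Finset.prod_nonneg fun i _ => hc i _)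
  have hB := card_restrictedPerms_le
    (fun i => Finset.univ.filter fun m => (τ i).symm m ≤ κ i)
  simp_rw [hcard] at hB
  refine le_trans (le_of_eq ?_) hB
  rw [restrictedPerms, Finset.card_filter, Nat.cast_sum]
  refine Finset.sum_congr rfl fun σ _ => ?_
  simp [Finset.prod_ite_zero]
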